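/- For a prime p, the cyclic group ℤ/pℤ has property L if and only if p ≤ 3. -/

import Mathlib

/-- The natural reduction ring homomorphism `W₂(k) → k` from length-two `p`-typical
Witt vectors to `k`, given by the zeroth coefficient. -/
noncomputable def wittReduce (p : ℕ) [Fact p.Prime] (k : Type*) [CommRing k] :
    TruncatedWittVector p 2 k →+* k :=
  RingHom.liftOfRightInverse (WittVector.truncate 2) TruncatedWittVector.out
    TruncatedWittVector.truncateFun_out
    ⟨WittVector.constantCoeff, fun x hx => by
      rw [WittVector.mem_ker_truncate] at hx
      simpa [RingHom.mem_ker] using hx 0 (by norm_num)⟩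

/-- A finite group `G` has property `L_p` if every homomorphism `G → GL_n(k)`, for `k` a
finite field of characteristic `p`, lifts to `GL_n(W₂(k))`. -/
def HasLp (p : ℕ) [Fact p.Prime] (G : Type*) [Group G] : Prop :=
  ∀ (n : ℕ), 1 ≤ n → ∀ (k : Type) [Field k] [Fintype k] [CharP k p],
    ∀ f : G →* GL (Fin n) k,
      ∃ g : G →* GL (Fin n) (TruncatedWittVector p 2 k),
        (Matrix.GeneralLinearGroup.map (wittReduce p k)).comp g = f

/-- A group has property `L` if it has property `L_p` for every prime `p`. -/
def HasL (G : Type*) [Group G] : Prop :=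
  ∀ (p : ℕ) [Fact p.Prime], HasLp p G

section Reduction

variable {p : ℕ} [Fact p.Prime] {k : Type*} [Field k]

theorem wittReduce_truncate (x : WittVector p k) :
    wittReduce p k (WittVector.truncate 2 x) = x.coeff 0 :=
  RingHom.liftOfRightInverse_comp_apply (WittVector.truncate 2) TruncatedWittVector.out
    TruncatedWittVector.truncateFun_out _ x

theorem wittReduce_surjective : Function.Surjective (wittReduce p k) := fun a =>
  ⟨WittVector.truncate 2 (WittVector.teichmuller p a), by
    rw [wittReduce_truncate, WittVector.teichmuller_coeff_zero]⟩

variable [CharP k p]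

theorem natCast_mul_eq_zero_iff_wittReduce_eq_zero (x : TruncatedWittVector p 2 k) :
    (p : TruncatedWittVector p 2 k) * x = 0 ↔ wittReduce p k x = 0 := by
  obtain ⟨y, rfl⟩ := WittVector.truncate_surjective p 2 k x
  rw [wittReduce_truncate, ← map_natCast (WittVector.truncate 2), ← map_mul, ← RingHom.mem_ker,
    WittVector.mem_ker_truncate, mul_comm]
  constructor
  · intro h
    have := h 1 (by norm_num)
    rw [WittVector.mul_charP_coeff_succ] at this
    exact eq_zero_of_pow_eq_zero this
  · intro h i hi
    interval_cases i
    · exact WittVector.mul_charP_coeff_zero y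
    · rw [WittVector.mul_charP_coeff_succ, h, zero_pow (Fact.out : p.Prime).ne_zero]

theorem mul_eq_zero_of_wittReduce_eq_zero [Finite k] (x y : TruncatedWittVector p 2 k)
    (hx : wittReduce p k x = 0) (hy : wittReduce p k y = 0) : x * y = 0 := by
  obtain ⟨z, rfl⟩ : ∃ z, (p : TruncatedWittVector p 2 k) * z = x := by
    obtain ⟨u, rfl⟩ := WittVector.truncate_surjective p 2 k x
    rw [wittReduce_truncate] at hx
    have : PerfectRing k p := inferInstance
    obtain ⟨c, hc⟩ := (bijective_frobenius k p).surjective (u.coeff 1)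
    refine ⟨WittVector.truncate 2 (WittVector.teichmuller p c), ?_⟩
    rw [← map_natCast (WittVector.truncate 2), ← map_mul, mul_comm]
    ext i
    fin_cases i
    · simp only [WittVector.coeff_truncate]
      exact (WittVector.mul_charP_coeff_zero _).trans hx.symm
    · simp only [WittVector.coeff_truncate]
      refine (WittVector.mul_charP_coeff_succ _ 0).trans ?_
      rw [WittVector.teichmuller_coeff_zero]
      exact hc
  rw [mul_right_comm, (natCast_mul_eq_zero_iff_wittReduce_eq_zero y).2 hy, zero_mul]

end Reduction

section SquareZero

variable {R k : Type*} [CommRing R] [Field k] {π : R →+* k} {n : Type*}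

theorem isUnit_of_map_ne_zero (hπ : Function.Surjective π)
    (hker : ∀ x y, π x = 0 → π y = 0 → x * y = 0) {x : R} (hx : π x ≠ 0) : IsUnit x := by
  obtain ⟨y, hy⟩ := hπ (π x)⁻¹
  have h : π (x * y - 1) = 0 := by rw [map_sub, map_mul, hy, mul_inv_cancel₀ hx, map_one, sub_self]
  have h2 := hker _ _ h h
  refine IsUnit.of_mul_eq_one (y * (2 - x * y)) ?_
  linear_combination -h2

theorem exists_map_eq (hπ : Function.Surjective π) (A : Matrix n n k) :
    ∃ B : Matrix n n R, B.map π = A := by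
  choose s hs using hπ
  exact ⟨A.map s, by ext i j; simp [hs]⟩

variable [Fintype n]

theorem matrix_mul_eq_zero (hker : ∀ x y, π x = 0 → π y = 0 → x * y = 0) {M N : Matrix n n R}
    (hM : M.map π = 0) (hN : N.map π = 0) : M * N = 0 := by
  ext i j
  rw [Matrix.mul_apply]
  exact Finset.sum_eq_zero fun l _ => hker _ _ (congrFun (congrFun hM i) l)
    (congrFun (congrFun hN l) j)

theorem one_add_pow_of_mul_self_eq_zero {S : Type*} [Ring S] {x : S} (hx : x * x = 0) (m : ℕ) :
    (1 + x) ^ m = 1 + m * x := by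
  induction m with
  | zero => simp
  | succ m ih =>
    rw [pow_succ, ih, add_mul, mul_add, mul_add, mul_one, mul_one, one_mul, mul_assoc (m : S), hx]
    push_cast
    noncomm_ring

variable [DecidableEq n]

theorem exists_lift_of_natCast_ne_zero (hπ : Function.Surjective π)
    (hker : ∀ x y, π x = 0 → π y = 0 → x * y = 0) {m : ℕ} (hm : (m : k) ≠ 0) (A : Matrix n n k)
    (hA : A ^ m = 1) : ∃ B : Matrix n n R, B.map π = A ∧ B ^ m = 1 := by
  obtain ⟨B, rfl⟩ := exists_map_eq hπ A
  obtain ⟨u, hu⟩ := (isUnit_of_map_ne_zero hπ hker (x := (m : R)) (by simpa using hm)).exists_left_inv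
  have hN : (B ^ m - 1).map π = 0 := by
    have := map_sub π.mapMatrix (B ^ m) 1
    rw [map_pow, map_one] at this
    exact this.trans (sub_eq_zero.2 hA)
  set N := B ^ m - 1 with hNdef
  have hNN : N * N = 0 := matrix_mul_eq_zero hker hN hN
  have hMM : (-(u • N)) * (-(u • N)) = 0 := by
    rw [neg_mul_neg, smul_mul_smul_comm, hNN, smul_zero]
  have hc : Commute B (1 + -(u • N)) := by
    refine (Commute.one_right B).add_right (Commute.neg_right (Commute.smul_right ?_ u))
    exact ((Commute.refl B).pow_right m).sub_right (Commute.one_right B)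
  refine ⟨B * (1 + -(u • N)), ?_, ?_⟩
  · have h0 : (u • N).map π = 0 := by
      ext i j
      simpa using Or.inr (congrFun (congrFun hN i) j)
    have := map_mul π.mapMatrix B (1 + -(u • N))
    rw [map_add, map_one, map_neg, show π.mapMatrix (u • N) = 0 from h0, neg_zero, add_zero,
      mul_one] at this
    exact this
  · rw [hc.mul_pow, one_add_pow_of_mul_self_eq_zero hMM, mul_neg, ← nsmul_eq_mul,
      ← Nat.cast_smul_eq_nsmul R, smul_smul, mul_comm (m : R), hu, one_smul,
      show B ^ m = 1 + N by rw [hNdef]; abel, add_mul, one_mul, mul_add, mul_one, mul_neg, hNN]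
    abel

theorem pow_ne_one_of_five_le {p : ℕ} (hp : p.Prime) (h5 : 5 ≤ p)
    (hker : ∀ x y, π x = 0 → π y = 0 → x * y = 0)
    (hpR : ∀ x, (p : R) * x = 0 ↔ π x = 0) {B : Matrix n n R}
    (h1 : B.map π ≠ 1) (h2 : (B.map π - 1) ^ 2 = 0) : B ^ p ≠ 1 := by
  intro hB
  set N := B - 1 with hN
  have hNmap : N.map π = B.map π - 1 := by
    have := map_sub π.mapMatrix B 1
    rwa [map_one] at this
  have hpM : ∀ M : Matrix n n R, (p : Matrix n n R) * M = 0 ↔ M.map π = 0 := by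
    intro M
    rw [← nsmul_eq_mul, ← Nat.cast_smul_eq_nsmul R]
    constructor
    · intro h
      ext i j
      exact (hpR _).1 (congrFun (congrFun h i) j)
    · intro h
      ext i j
      exact (hpR _).2 (congrFun (congrFun h i) j)
  have hN2 : (N ^ 2).map π = 0 := by
    have := map_pow π.mapMatrix N 2
    refine this.trans ?_
    rw [RingHom.mapMatrix_apply, hNmap, h2]
  have hpN2 := (hpM _).2 hN2
  have hNp : N ^ p = 0 := by
    have h4 : N ^ 4 = 0 := by
      rw [show 4 = 2 + 2 by norm_num, pow_add]
      exact matrix_mul_eq_zero hker hN2 hN2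
    exact pow_eq_zero_of_le (by lia) h4
  have hexp := (Commute.one_right N).add_pow_prime_eq hp
  rw [hNp, one_pow, hN, sub_add_cancel, hB, ← hN, Finset.mul_sum,
    Finset.sum_eq_single_of_mem 1 (by simp; lia)] at hexp
  · simp only [mul_one, tsub_self, pow_zero, one_pow, Nat.choose_one_right,
      Nat.div_self hp.pos, Nat.cast_one, zero_add] at hexp
    have h0 : (p : Matrix n n R) * N = 0 := by simpa using hexp
    rw [hpM, hNmap, sub_eq_zero] at h0
    exact h1 h0
  · intro i hi hi1
    obtain ⟨j, rfl⟩ : ∃ j, i = j + 2 := ⟨i - 2, by simp at hi; lia⟩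
    rw [mul_one, show j + 2 - 1 = j + 1 by lia, pow_succ', one_pow, mul_one, ← mul_assoc,
      ← mul_assoc, mul_assoc (p : Matrix n n R), ← sq, hpN2, zero_mul, zero_mul]

end SquareZero

section Jordan

open Polynomial Module
open scoped Matrix

variable {R k : Type*} [CommRing R] [Field k] (π : R →+* k)

/-- The `k[X]`-module `M` has a `k`-basis in which multiplication by `X` is the reduction of a
matrix over `R` with trivial `m`-th power. -/
def HasLiftableBasis (m : ℕ) (M : Type*) [AddCommGroup M] [Module k M] [Module k[X] M] : Prop :=
  ∃ (ι : Type) (_ : Fintype ι) (_ : DecidableEq ι) (b : Basis ι k M) (B : Matrix ι ι R),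
    B ^ m = 1 ∧ ∀ j, (X : k[X]) • b j = ∑ i, π (B i j) • b i

variable {π} {m : ℕ}

theorem hasLiftableBasis_quotient {g : R[X]} (hg : g.Monic) (hdvd : g ∣ X ^ m - 1) {f : k[X]}
    (hf : g.map π = f) : HasLiftableBasis π m (k[X] ⧸ k[X] ∙ f) := by
  subst hf
  obtain ⟨b, hb⟩ : ∃ b : Basis (Fin g.natDegree) R (AdjoinRoot g),
      ∀ i, b i = AdjoinRoot.root g ^ (i : ℕ) :=
    ⟨_, (AdjoinRoot.powerBasis' hg).basis_eq_pow⟩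
  obtain ⟨b', hb'⟩ : ∃ b : Basis (Fin g.natDegree) k (AdjoinRoot (g.map π)),
      ∀ i, b i = AdjoinRoot.root (g.map π) ^ (i : ℕ) := by
    rw [← hg.natDegree_map π]
    exact ⟨_, (AdjoinRoot.powerBasis' (hg.map π)).basis_eq_pow⟩
  refine ⟨Fin g.natDegree, inferInstance, inferInstance, b',
    Algebra.leftMulMatrix b (AdjoinRoot.root g), ?_, fun j => ?_⟩
  · rw [← map_pow]
    have : AdjoinRoot.root g ^ m = 1 := by
      have h := (AdjoinRoot.mk_eq_zero (f := g)).2 hdvd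
      simpa [sub_eq_zero] using h
    rw [this, map_one]
  · have h : AdjoinRoot.root g * b j
        = ∑ i, Algebra.leftMulMatrix b (AdjoinRoot.root g) i j • b i := by
      simp_rw [Algebra.leftMulMatrix_eq_repr_mul]
      exact (b.sum_repr _).symm
    have h2 := congrArg (AdjoinRoot.map π g (g.map π) dvd_rfl) h
    simp only [map_mul, map_sum, Algebra.smul_def, AdjoinRoot.algebraMap_eq, hb, map_pow,
      AdjoinRoot.map_root, AdjoinRoot.map_of] at h2
    have h3 : AdjoinRoot.root (g.map π) * b' j
        = ∑ i, π (Algebra.leftMulMatrix b (AdjoinRoot.root g) i j) • b' i := by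
      simpa only [hb', Algebra.smul_def, AdjoinRoot.algebraMap_eq] using h2
    exact h3

theorem HasLiftableBasis.directSum {κ : Type} [Fintype κ] [DecidableEq κ] {M : κ → Type*}
    [∀ i, AddCommGroup (M i)] [∀ i, Module k (M i)] [∀ i, Module k[X] (M i)]
    (h : ∀ i, HasLiftableBasis π m (M i)) :
    HasLiftableBasis π m (DirectSum κ M) := by
  choose ι _ _ b B hB hX using h
  refine ⟨Σ i, ι i, inferInstance, inferInstance,
    (Pi.basis b).map (DirectSum.linearEquivFunOnFintype k κ M).symm, Matrix.blockDiagonal' B, ?_, ?_⟩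
  · rw [← Matrix.blockDiagonal'_pow, show B ^ m = 1 from funext hB, Matrix.blockDiagonal'_one]
  · rintro ⟨i, j⟩
    simp only [Basis.map_apply, Pi.basis_apply, DirectSum.linearEquivFunOnFintype_symm_single,
      Fintype.sum_sigma]
    rw [Finset.sum_eq_single_of_mem i (Finset.mem_univ i)]
    · have hlof (x : M i) : DirectSum.lof k κ M i x = DirectSum.lof k[X] κ M i x := rfl
      simp only [Matrix.blockDiagonal'_apply_eq, ← map_smul]
      rw [hlof, ← map_smul, hX, ← hlof, map_sum]
    · intro i' _ hi'
      refine Finset.sum_eq_zero fun j' _ => ?_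
      rw [Matrix.blockDiagonal'_apply_ne _ _ _ hi', map_zero, zero_smul]

theorem HasLiftableBasis.of_equiv {M N : Type*} [AddCommGroup M] [Module k M] [Module k[X] M]
    [AddCommGroup N] [Module k N] [Module k[X] N] [IsScalarTower k k[X] M] [IsScalarTower k k[X] N]
    (e : M ≃ₗ[k[X]] N) (h : HasLiftableBasis π m N) : HasLiftableBasis π m M := by
  obtain ⟨ι, _, _, b, B, hB, hX⟩ := h
  refine ⟨ι, _, _, b.map (e.restrictScalars k).symm, B, hB, fun j => ?_⟩
  apply e.injective
  have := hX j
  have hs (x : k) (y : M) : e (x • y) = x • e y := (e.restrictScalars k).map_smul x y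
  have hbe (j : ι) : e ((e.restrictScalars k).symm (b j)) = b j := e.apply_symm_apply _
  simpa [hs, hbe] using this

theorem hasLiftableBasis_aeval {p : ℕ} [Fact p.Prime] [CharP k p]
    (hlift : ∀ e ≤ p, ∃ g : R[X], g.Monic ∧ g ∣ X ^ p - 1 ∧ g.map π = (X - 1) ^ e)
    {V : Type*} [AddCommGroup V] [Module k V] [FiniteDimensional k V] (φ : V →ₗ[k] V)
    (hφ : φ ^ p = 1) : HasLiftableBasis π p (AEval' φ) := by
  have hirr : Irreducible (X - 1 : k[X]) := by simpa using irreducible_X_sub_C (1 : k)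
  have hkill : ∀ x : AEval' φ, (X - 1 : k[X]) ^ p • x = 0 := by
    intro x
    obtain ⟨v, rfl⟩ := (AEval'.of φ).surjective x
    rw [sub_pow_char, one_pow, sub_smul, one_smul, AEval'.X_pow_smul_of, hφ]
    simp
  obtain ⟨d, e, ⟨E⟩⟩ := torsion_by_prime_power_decomposition hirr (M := AEval' φ)
    ((Submodule.isTorsion'_powers_iff _).2 fun x => ⟨p, hkill x⟩)
  have he : ∀ i, e i ≤ p := by
    intro i
    have h := congrArg E (hkill (E.symm (DirectSum.lof k[X] (Fin d)
      (fun i => k[X] ⧸ k[X] ∙ (X - 1 : k[X]) ^ e i) i (Submodule.Quotient.mk 1))))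
    rw [map_smul, E.apply_symm_apply, map_zero, ← map_smul, ← map_zero (DirectSum.lof k[X] (Fin d)
      (fun i => k[X] ⧸ k[X] ∙ (X - 1 : k[X]) ^ e i) i)] at h
    have h := DFinsupp.single_injective h
    rw [← Submodule.Quotient.mk_smul, Submodule.Quotient.mk_eq_zero, smul_eq_mul, mul_one,
      Submodule.mem_span_singleton] at h
    obtain ⟨a, ha⟩ := h
    exact (pow_dvd_pow_iff hirr.ne_zero hirr.not_isUnit).1 ⟨a, by rw [← ha, smul_eq_mul, mul_comm]⟩
  refine HasLiftableBasis.of_equiv E (HasLiftableBasis.directSum fun i => ?_)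
  obtain ⟨g, hg, hd, hm⟩ := hlift (e i) (he i)
  exact hasLiftableBasis_quotient hg hd hm

theorem exists_lift_of_factors {p : ℕ} [Fact p.Prime] [CharP k p] (hπ : Function.Surjective π)
    (hker : ∀ x y, π x = 0 → π y = 0 → x * y = 0)
    (hlift : ∀ e ≤ p, ∃ g : R[X], g.Monic ∧ g ∣ X ^ p - 1 ∧ g.map π = (X - 1) ^ e)
    {n : Type*} [Fintype n] [DecidableEq n] (A : Matrix n n k) (hA : A ^ p = 1) :
    ∃ B : Matrix n n R, B.map π = A ∧ B ^ p = 1 := by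
  obtain ⟨ι, _, _, b, C, hC, hX⟩ := hasLiftableBasis_aeval hlift (Matrix.toLin' A)
    (by rw [← Matrix.toLin'_pow, hA, Matrix.toLin'_one]; rfl)
  let c := b.map (AEval'.of (Matrix.toLin' A)).symm
  have hc : ∀ j, A *ᵥ c j = ∑ i, π (C i j) • c i := by
    intro j
    have := congrArg (AEval'.of (Matrix.toLin' A)).symm (hX j)
    rw [AEval'.of_symm_X_smul, map_sum] at this
    simp only [map_smul] at this
    exact this
  let σ : ι ≃ n := c.indexEquiv (Pi.basisFun k n)
  let d := c.reindex σ
  let D : Matrix n n R := C.reindex σ σ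
  have hD : D ^ p = 1 := by
    have := map_pow (Matrix.reindexAlgEquiv R R σ) C p
    rw [hC, map_one] at this
    exact this.symm
  have hd : ∀ j, A *ᵥ d j = ∑ i, π (D i j) • d i := by
    intro j
    simp only [d, D, Basis.reindex_apply, Matrix.reindex_apply, Matrix.submatrix_apply, hc]
    exact Fintype.sum_equiv σ _ _ fun i => by simp
  let P : Matrix n n k := (Pi.basisFun k n).toMatrix d
  have hAP : A * P = P * D.map π := by
    ext i j
    have h := congrFun (hd j) i
    rw [Finset.sum_apply] at h
    refine h.trans ?_
    rw [Matrix.mul_apply]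
    exact Finset.sum_congr rfl fun l _ => mul_comm _ _
  have hP : P.det ≠ 0 := by
    have : Invertible P := (Pi.basisFun k n).invertibleToMatrix d
    exact (Matrix.isUnit_det_of_invertible P).ne_zero
  obtain ⟨Q, hQ⟩ := exists_map_eq hπ P
  have hQu : IsUnit Q.det := by
    refine isUnit_of_map_ne_zero hπ hker ?_
    rw [RingHom.map_det, RingHom.mapMatrix_apply, hQ]
    exact hP
  obtain ⟨U, rfl⟩ := (Matrix.isUnit_iff_isUnit_det Q).2 hQu
  refine ⟨U * D * (↑U⁻¹ : Matrix n n R), ?_, ?_⟩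
  · have h1 : π.mapMatrix U = P := hQ
    have h2 : P * π.mapMatrix (↑U⁻¹ : Matrix n n R) = 1 := by
      rw [← h1, ← map_mul, Units.mul_inv, map_one]
    change π.mapMatrix ((U : Matrix n n R) * D * (↑U⁻¹ : Matrix n n R)) = A
    rw [map_mul, map_mul, h1, RingHom.mapMatrix_apply π D, ← hAP, mul_assoc, h2, mul_one]
  · rw [Units.conj_pow, hD, mul_one, Units.mul_inv]

theorem exists_factor_lift {p : ℕ} [Fact p.Prime] [CharP k p] (hp : p ≤ 3) (e : ℕ) (he : e ≤ p) :
    ∃ g : R[X], g.Monic ∧ g ∣ X ^ p - 1 ∧ g.map π = (X - 1) ^ e := by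
  have hp2 := (Fact.out : p.Prime).two_le
  rcases he.eq_or_lt with rfl | hlt
  · refine ⟨X ^ e - 1, monic_X_pow_sub_C 1 (by lia), dvd_rfl, ?_⟩
    rw [sub_pow_char]
    simp
  · obtain rfl | rfl | ⟨rfl, rfl⟩ : e = 0 ∨ e = 1 ∨ (e = 2 ∧ p = 3) := by lia
    · exact ⟨1, monic_one, one_dvd _, by simp⟩
    · refine ⟨X - 1, monic_X_sub_C 1, sub_one_dvd_pow_sub_one _ _, by simp⟩
    · refine ⟨X ^ 2 + X + 1, by monicity!, ⟨X - 1, by ring⟩, ?_⟩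
      have h3 : (3 : k[X]) = 0 := by exact_mod_cast CharP.cast_eq_zero k[X] 3
      simp only [Polynomial.map_add, Polynomial.map_pow, map_X, Polynomial.map_one]
      linear_combination X * h3

end Jordan

theorem hasLp_multiplicative_zmod_iff {q p : ℕ} [Fact q.Prime] [NeZero p] :
    HasLp q (Multiplicative (ZMod p)) ↔ ∀ n : ℕ, 1 ≤ n → ∀ (k : Type) [Field k] [Fintype k]
      [CharP k q] (A : Matrix (Fin n) (Fin n) k), A ^ p = 1 →
      ∃ B : Matrix (Fin n) (Fin n) (TruncatedWittVector q 2 k),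
        B.map (wittReduce q k) = A ∧ B ^ p = 1 := by
  have hlift : ∀ {H : Type} [Group H] (u : H), u ^ p = 1 →
      ∃ f : Multiplicative (ZMod p) →* H, f (.ofAdd 1) = u := by
    intro H _ u hu
    have hz : zmultiplesHom (Additive H) (.ofMul u) (p : ℤ) = 0 := by
      simpa using congrArg Additive.ofMul hu
    refine ⟨AddMonoidHom.toMultiplicativeLeft
      (ZMod.lift p ⟨zmultiplesHom (Additive H) (.ofMul u), hz⟩), ?_⟩
    · have h := ZMod.lift_coe p ⟨zmultiplesHom (Additive H) (.ofMul u), hz⟩ 1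
      rw [Int.cast_one] at h
      simpa using congrArg Additive.toMul h
  have hgen : (Multiplicative.ofAdd (1 : ZMod p)) ^ p = 1 := by
    rw [← ofAdd_nsmul]; simp
  constructor
  · intro h n hn k _ _ _ A hA
    obtain ⟨f, hf⟩ := hlift (Units.ofPowEqOne A p hA (NeZero.ne p)) (by ext1; simp)
    obtain ⟨g, hg⟩ := h n hn k f
    refine ⟨g (.ofAdd 1), ?_, ?_⟩
    · have := congrArg Units.val (DFunLike.congr_fun hg (.ofAdd 1))
      rw [hf] at this
      exact this
    · rw [← Units.val_pow_eq_pow_val, ← map_pow, hgen, map_one, Units.val_one]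
  · intro h n hn k _ _ _ f
    obtain ⟨B, hB, hBp⟩ := h n hn k (f (.ofAdd 1))
      (by rw [← Units.val_pow_eq_pow_val, ← map_pow, hgen, map_one, Units.val_one])
    obtain ⟨g, hg⟩ := hlift (Units.ofPowEqOne B p hBp (NeZero.ne p)) (by ext1; simp)
    refine ⟨g, MonoidHom.ext fun x => ?_⟩
    obtain ⟨j, rfl⟩ : ∃ j : ℕ, x = .ofAdd (1 : ZMod p) ^ j :=
      ⟨x.toAdd.val, by rw [← ofAdd_nsmul]; simp⟩
    rw [map_pow, map_pow]
    congr 1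
    rw [MonoidHom.comp_apply, hg]
    ext1
    exact hB

theorem hasL_zmod_of_le_three {p : ℕ} (hp : p.Prime) (h3 : p ≤ 3) :
    HasL (Multiplicative (ZMod p)) := by
  intro q hq
  have : NeZero p := ⟨hp.ne_zero⟩
  rw [hasLp_multiplicative_zmod_iff]
  intro n _ k _ _ _ A hA
  by_cases hqp : q = p
  · subst hqp
    exact exists_lift_of_factors wittReduce_surjective mul_eq_zero_of_wittReduce_eq_zero
      (exists_factor_lift h3) A hA
  · refine exists_lift_of_natCast_ne_zero wittReduce_surjective mul_eq_zero_of_wittReduce_eq_zero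
      ?_ A hA
    rw [Ne, CharP.cast_eq_zero_iff k q, Nat.prime_dvd_prime_iff_eq hq.out hp]
    exact hqp

theorem not_hasLp_zmod_of_five_le {p : ℕ} [hp : Fact p.Prime] (h5 : 5 ≤ p) :
    ¬ HasLp p (Multiplicative (ZMod p)) := by
  rw [hasLp_multiplicative_zmod_iff]
  intro h
  have hE : (!![0, 1; 0, 0] : Matrix (Fin 2) (Fin 2) (ZMod p)) * !![0, 1; 0, 0] = 0 := by
    ext i j
    fin_cases i <;> fin_cases j <;> simp
  obtain ⟨B, hB, hBp⟩ := h 2 (by norm_num) (ZMod p) (1 + !![0, 1; 0, 0]) (by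
    rw [one_add_pow_of_mul_self_eq_zero hE, CharP.cast_eq_zero, zero_mul, add_zero])
  refine pow_ne_one_of_five_le hp.out h5 mul_eq_zero_of_wittReduce_eq_zero
    natCast_mul_eq_zero_iff_wittReduce_eq_zero ?_ ?_ hBp
  · rw [hB]
    intro h
    simpa [Matrix.add_apply] using congrFun (congrFun h 0) 1
  · rw [hB, add_sub_cancel_left, sq, hE]

/-- the cyclic group `ℤ/pℤ` has property `L` if and only if `p ≤ 3`. -/
theorem zmod_p_hasL_iff (p : ℕ) (hp : p.Prime) :
    HasL (Multiplicative (ZMod p)) ↔ p ≤ 3 := by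
  refine ⟨fun h => ?_, hasL_zmod_of_le_three hp⟩
  have : Fact p.Prime := ⟨hp⟩
  by_contra! h3
  have h4 : p ≠ 4 := by
    rintro rfl
    norm_num at hp
  exact not_hasLp_zmod_of_five_le (by lia) (h p)
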